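/- Suppose given, for each ω ∈ ℝ, functions R_out(ω,·), R_inc(ω,·) : (r₊, r_c) → ℂ solving the radial o.d.e. with frequency ω, together with δ > 0 and functions Ĥ₊ : ℝ × [r₊, r₊ + δ) → ℂ and Ĥ_c : ℝ × (r_c − δ, r_c] → ℂ, C¹ in r with Ĥ₊(ω, r₊) = Ĥ_c(ω, r_c) = 1, such that R_out(ω,r) = (r − r₊)^(iω/(2κ₊))·Ĥ₊(ω,r) for r ∈ (r₊, r₊ + δ) and R_inc(ω,r) = (r_c − r)^(−iω/(2κ_c))·Ĥ_c(ω,r) for r ∈ (r_c − δ, r_c). Assume moreover that for each fixed r ∈ (r₊, r_c), the maps ω ↦ R_out(ω,r) and ω ↦ R_inc(ω,r) are continuous on ℝ. Then there exists ω ∈ ℝ such that R_out(ω,·) and R_inc(ω,·) are linearly independent over ℂ. -/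

import Mathlib

noncomputable section

/-- The metric coefficient `μ(r) = 1 - 2M/r + e²/r² - (Λ/3)r²`. -/
def mu (M e Λ : ℝ) (r : ℝ) : ℝ := 1 - 2*M/r + e^2/r^2 - (Λ/3)*r^2

/-- Surface gravity of the event horizon: `κ₊ = (1/2)·μ′(r₊)`. -/
def kappaP (M e Λ rp : ℝ) : ℝ := (1/2) * deriv (mu M e Λ) rp

/-- Surface gravity of the Cauchy horizon: `κ₋ = -(1/2)·μ′(r₋)`. -/
def kappaM (M e Λ rm : ℝ) : ℝ := -(1/2) * deriv (mu M e Λ) rm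

/-- Surface gravity of the cosmological horizon: `κ_c = -(1/2)·μ′(r_c)`. -/
def kappaC (M e Λ rc : ℝ) : ℝ := -(1/2) * deriv (mu M e Λ) rc

/-- A twice-differentiable `R : I → ℂ` solves the radial o.d.e. with frequency `ω`:
`r⁻²·μ(r)·(d/dr)(r²·μ(r)·R′(r)) + ω²·R(r) = 0` for all `r ∈ I`. -/
def SolvesODE (M e Λ : ℝ) (ω : ℂ) (I : Set ℝ) (R : ℝ → ℂ) : Prop :=
  (∀ r ∈ I, DifferentiableAt ℝ R r) ∧
  (∀ r ∈ I, DifferentiableAt ℝ (deriv R) r) ∧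
  ∀ r ∈ I, ((r:ℂ)^2)⁻¹ * (mu M e Λ r : ℂ) *
      deriv (fun s : ℝ => (s:ℂ)^2 * (mu M e Λ s : ℂ) * deriv R s) r
    + ω^2 * R r = 0

/-- The set `𝒰` of `ω ∈ ℂ` not of the form `i·κ·n` with `κ ∈ {κ₊, κ₋, κ_c}` and
`n` a nonzero integer. -/
def calU (kp km kc : ℝ) : Set ℂ :=
  {ω : ℂ | ∀ κ ∈ ({kp, km, kc} : Set ℝ), ∀ n : ℤ, n ≠ 0 → ω ≠ Complex.I * κ * n}

open Set Filter Topology ComplexConjugate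

section HorizonAsymptotics

variable {S : Set ℝ} {p : ℝ} {q : ℝ → ℝ} {G R H : ℝ → ℂ}

/-- Near a simple zero `p` of `G`, a function `R = |r - p|^(iβ) H` with `H` of class `C¹` up to
`p` has `|r - p|^(-iβ) G R' → iβ q(p)`, where `G = (r - p) q`. -/
theorem tendsto_horizon_momentum {β : ℝ} (hS : IsOpen S) (hp : p ∉ S)
    (hT : UniqueDiffOn ℝ (insert p S)) (hH : ContDiffOn ℝ 1 H (insert p S)) (hHp : H p = 1)
    (hq : ContinuousAt q p) (hG : ∀ r ∈ S, G r = (((r - p) * q r : ℝ) : ℂ))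
    (hR : ∀ r ∈ S, R r = Complex.exp (Complex.I * β * (Real.log (r - p) : ℝ)) * H r) :
    Tendsto (fun r => G r * deriv R r * Complex.exp (-(Complex.I * β * (Real.log (r - p) : ℝ))))
      (𝓝[S] p) (𝓝 (Complex.I * β * q p)) := by
  set T := insert p S
  have hST : S ⊆ T := subset_insert _ _
  have hpT : p ∈ T := mem_insert _ _
  have hH' : ContinuousWithinAt (derivWithin H T) S p :=
    ((hH.continuousOn_derivWithin hT le_rfl) p hpT).mono hST
  have hHc : ContinuousWithinAt H S p := ((hH.continuousOn) p hpT).mono hST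
  have hqc : Tendsto (fun r => ((q r : ℝ) : ℂ)) (𝓝[S] p) (𝓝 (q p)) :=
    (Complex.continuous_ofReal.continuousAt.comp hq).tendsto.mono_left nhdsWithin_le_nhds
  have hx : Tendsto (fun r : ℝ => ((r - p : ℝ) : ℂ)) (𝓝[S] p) (𝓝 0) := by
    have : Continuous (fun r : ℝ => ((r - p : ℝ) : ℂ)) := by fun_prop
    simpa using (this.tendsto p).mono_left nhdsWithin_le_nhds
  have hlim : Tendsto
      (fun r => (q r : ℂ) * (Complex.I * β * H r + ((r - p : ℝ) : ℂ) * derivWithin H T r))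
      (𝓝[S] p) (𝓝 (Complex.I * β * q p)) := by
    have := hqc.mul (((tendsto_const_nhds (x := Complex.I * (β : ℂ))).mul hHc.tendsto).add
      (hx.mul hH'.tendsto))
    rw [hHp] at this
    convert this using 2
    ring
  refine hlim.congr' ?_
  filter_upwards [self_mem_nhdsWithin] with r hr
  have hrp : r - p ≠ 0 := sub_ne_zero.mpr fun h => hp (h ▸ hr)
  have hdH : HasDerivAt H (derivWithin H T r) r :=
    (((hH.differentiableOn one_ne_zero) r (hST hr)).hasDerivWithinAt).hasDerivAt
      (mem_of_superset (hS.mem_nhds hr) hST)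
  have hlog : HasDerivAt (fun s : ℝ => ((Real.log (s - p) : ℝ) : ℂ)) (((r - p)⁻¹ : ℝ) : ℂ) r := by
    have := (((hasDerivAt_id r).sub_const p).log hrp).ofReal_comp
    simpa using this
  have hdR := ((hlog.const_mul (Complex.I * (β : ℂ))).cexp).mul hdH
  have hdR' : deriv R r = _ := (hdR.congr_of_eventuallyEq
    (by filter_upwards [hS.mem_nhds hr] with s hs using hR s hs)).deriv
  have hrpC : (r : ℂ) - p ≠ 0 := by exact_mod_cast hrp
  rw [hdR', hG r hr, Complex.exp_neg]
  have := Complex.exp_ne_zero (Complex.I * β * (Real.log (r - p) : ℝ))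
  push_cast
  field_simp

end HorizonAsymptotics

section Radial

variable {M e Λ : ℝ}

theorem hasDerivAt_of_factor {f : ℝ → ℝ} {p : ℝ} {q : ℝ → ℝ} (hp : p ≠ 0)
    (hq : DifferentiableAt ℝ q p) (h : ∀ r ≠ 0, r ^ 2 * f r = (r - p) * q r) :
    HasDerivAt f (q p / p ^ 2) p := by
  have h1 := (((hasDerivAt_id p).sub_const p).mul hq.hasDerivAt).div
    ((hasDerivAt_id p).pow 2) (by simpa using hp)
  have h2 := h1.congr_of_eventuallyEq (f₁ := f) (by
    filter_upwards [isOpen_ne.mem_nhds hp] with s hs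
    have : s ≠ 0 := hs
    simp only [Pi.div_apply, Pi.mul_apply, Pi.pow_apply, id, ← h s hs]
    field_simp)
  refine h2.congr_deriv ?_
  simp only [Pi.mul_apply, Pi.pow_apply, id]
  field_simp
  ring

theorem differentiableAt_mu {r : ℝ} (hr : r ≠ 0) : DifferentiableAt ℝ (mu M e Λ) r := by
  unfold mu
  fun_prop (disch := simpa using hr)

/-- The weighted derivative `r² μ R'`. -/
def radialMomentum (M e Λ : ℝ) (R : ℝ → ℂ) (s : ℝ) : ℂ :=
  (s : ℂ) ^ 2 * (mu M e Λ s : ℂ) * deriv R s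

variable {I : Set ℝ} {R : ℝ → ℂ} {ω : ℝ}

theorem SolvesODE.differentiableAt_radialMomentum (h : SolvesODE M e Λ ω I R) {r : ℝ}
    (hr : r ∈ I) (hr0 : r ≠ 0) : DifferentiableAt ℝ (radialMomentum M e Λ R) r := by
  have h1 : DifferentiableAt ℝ (fun s : ℝ => (mu M e Λ s : ℂ)) r :=
    ((differentiableAt_mu hr0).hasDerivAt.ofReal_comp).differentiableAt
  have h2 : DifferentiableAt ℝ (fun s : ℝ => (s : ℂ)) r :=
    ((hasDerivAt_id r).ofReal_comp).differentiableAt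
  exact ((h2.pow 2).mul h1).mul (h.2.1 r hr)

theorem SolvesODE.mu_mul_deriv_radialMomentum (h : SolvesODE M e Λ ω I R) {r : ℝ}
    (hr : r ∈ I) (hr0 : r ≠ 0) :
    (mu M e Λ r : ℂ) * deriv (radialMomentum M e Λ R) r = -((ω ^ 2 * r ^ 2 : ℝ) : ℂ) * R r := by
  have h1 := h.2.2 r hr
  have hr0' : (r : ℂ) ≠ 0 := by exact_mod_cast hr0
  change ((r : ℂ) ^ 2)⁻¹ * (mu M e Λ r : ℂ) * deriv (radialMomentum M e Λ R) r + _ = 0 at h1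
  field_simp at h1
  push_cast
  linear_combination h1

/-- For real frequencies the flux `Im (R̄ r² μ R')` is conserved. -/
theorem SolvesODE.flux_eq (h : SolvesODE M e Λ ω I R) (hI : IsOpen I) (hI' : IsPreconnected I)
    (h0 : ∀ r ∈ I, r ≠ 0) (hmu : ∀ r ∈ I, mu M e Λ r ≠ 0) {x y : ℝ} (hx : x ∈ I) (hy : y ∈ I) :
    (conj (R x) * radialMomentum M e Λ R x).im = (conj (R y) * radialMomentum M e Λ R y).im := by
  have key : ∀ r ∈ I, HasDerivAt (fun s => (conj (R s) * radialMomentum M e Λ R s).im) 0 r := by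
    intro r hr
    have h1 := ((h.1 r hr).hasDerivAt.star).mul
      (h.differentiableAt_radialMomentum hr (h0 r hr)).hasDerivAt
    have h2 := Complex.imCLM.hasFDerivAt.comp_hasDerivAt r h1
    have h3 := h.mu_mul_deriv_radialMomentum hr (h0 r hr)
    have hz : (conj (R r) * deriv (radialMomentum M e Λ R) r).im = 0 := by
      have h4 : (mu M e Λ r : ℂ) * (conj (R r) * deriv (radialMomentum M e Λ R) r)
          = ((-(ω ^ 2 * r ^ 2) * Complex.normSq (R r) : ℝ) : ℂ) := by
        rw [Complex.ofReal_mul, Complex.normSq_eq_conj_mul_self]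
        push_cast at h3 ⊢
        linear_combination conj (R r) * h3
      have h5 := congrArg Complex.im h4
      rw [Complex.im_ofReal_mul, Complex.ofReal_im] at h5
      exact (mul_eq_zero.mp h5).resolve_left (hmu r hr)
    have hz' : (conj (deriv R r) * radialMomentum M e Λ R r).im = 0 := by
      have : conj (deriv R r) * radialMomentum M e Λ R r
          = ((r ^ 2 * mu M e Λ r * Complex.normSq (deriv R r) : ℝ) : ℂ) := by
        rw [Complex.ofReal_mul, Complex.normSq_eq_conj_mul_self, radialMomentum]
        push_cast
        ring
      rw [this, Complex.ofReal_im]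
    refine h2.congr_deriv ?_
    change (conj (deriv R r) * radialMomentum M e Λ R r +
      conj (R r) * deriv (radialMomentum M e Λ R) r).im = 0
    rw [Complex.add_im, hz, hz', add_zero]
  exact hI.is_const_of_deriv_eq_zero hI'
    (fun r hr => (key r hr).differentiableAt.differentiableWithinAt)
    (fun r hr => (key r hr).deriv) hx hy

variable {S : Set ℝ} {p d : ℝ} {q : ℝ → ℝ} {H : ℝ → ℂ}

theorem cpow_abs_sub_eq_exp {r : ℝ} (hr : r ≠ p) (β : ℝ) :
    ((|r - p| : ℝ) : ℂ) ^ (Complex.I * β) =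
      Complex.exp (Complex.I * β * (Real.log (r - p) : ℝ)) := by
  have : ((|r - p| : ℝ) : ℂ) ≠ 0 := by
    exact_mod_cast (abs_ne_zero.mpr (sub_ne_zero.mpr hr))
  rw [Complex.cpow_def_of_ne_zero this, ← Complex.ofReal_log (abs_nonneg _), Real.log_abs,
    mul_comm]

/-- The flux of a solution with oscillating behaviour `|r - p|^(iω/d) H` at the simple zero `p` of
`μ`, with `d = μ'(p)`, equals `ω p²`. -/
theorem SolvesODE.flux_eq_of_horizon (h : SolvesODE M e Λ ω I R) (hI : IsOpen I)
    (hI' : IsPreconnected I) (h0 : ∀ r ∈ I, r ≠ 0) (hmu : ∀ r ∈ I, mu M e Λ r ≠ 0)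
    (hS : IsOpen S) (hSI : S ⊆ I) (hp : p ∉ S) (hpS : (𝓝[S] p).NeBot)
    (hT : UniqueDiffOn ℝ (insert p S)) (hH : ContDiffOn ℝ 1 H (insert p S)) (hHp : H p = 1)
    (hq : ContinuousAt q p) (hG : ∀ r ∈ S, r ^ 2 * mu M e Λ r = (r - p) * q r)
    (hd : d ≠ 0) (hqd : q p = p ^ 2 * d)
    (hR : ∀ r ∈ S, R r = ((|r - p| : ℝ) : ℂ) ^ (Complex.I * (ω / d : ℝ)) * H r)
    {x : ℝ} (hx : x ∈ I) :
    (conj (R x) * radialMomentum M e Λ R x).im = ω * p ^ 2 := by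
  have hR' : ∀ r ∈ S, R r =
      Complex.exp (Complex.I * (ω / d : ℝ) * (Real.log (r - p) : ℝ)) * H r := fun r hr => by
    rw [hR r hr, cpow_abs_sub_eq_exp (ne_of_mem_of_not_mem hr hp)]
  have hlim := tendsto_horizon_momentum (G := fun r => (r : ℂ) ^ 2 * (mu M e Λ r : ℂ))
    hS hp hT hH hHp hq (fun r hr => by rw [← hG r hr]; push_cast; ring) hR'
  have hHc : Tendsto (fun r => conj (H r)) (𝓝[S] p) (𝓝 1) := by
    have h1 : ContinuousWithinAt H S p :=
      ((hH.continuousOn) p (mem_insert _ _)).mono (subset_insert _ _)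
    have h2 := (Complex.continuous_conj.tendsto (H p)).comp h1.tendsto
    simpa [hHp, Function.comp_def] using h2
  have hlim2 := (Complex.continuous_im.tendsto _).comp (hHc.mul hlim)
  have hconst : Tendsto (fun r => (conj (R r) * radialMomentum M e Λ R r).im) (𝓝[S] p)
      (𝓝 (conj (R x) * radialMomentum M e Λ R x).im) := by
    refine tendsto_const_nhds.congr' ?_
    filter_upwards [self_mem_nhdsWithin] with r hr
    exact h.flux_eq hI hI' h0 hmu hx (hSI hr)
  refine (tendsto_nhds_unique hconst (hlim2.congr' ?_)).trans ?_
  · filter_upwards [self_mem_nhdsWithin] with r hr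
    have : conj (R r) =
        Complex.exp (-(Complex.I * (ω / d : ℝ) * (Real.log (r - p) : ℝ))) * conj (H r) := by
      rw [hR' r hr, map_mul, ← Complex.exp_conj]
      simp
    simp only [Function.comp_apply, this, radialMomentum]
    congr 1
    ring
  · rw [hqd, one_mul, mul_assoc, ← Complex.ofReal_mul, Complex.I_mul_im, Complex.ofReal_re]
    field_simp

/-- A static solution that is `C¹` up to a simple zero of `μ` is constant. -/
theorem SolvesODE.eq_one_of_static (h : SolvesODE M e Λ (0 : ℝ) I R) (hI : IsOpen I)
    (hI' : IsPreconnected I) (h0 : ∀ r ∈ I, r ≠ 0) (hmu : ∀ r ∈ I, mu M e Λ r ≠ 0)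
    (hS : IsOpen S) (hSI : S ⊆ I) (hp : p ∉ S) (hpS : (𝓝[S] p).NeBot)
    (hT : UniqueDiffOn ℝ (insert p S)) (hH : ContDiffOn ℝ 1 H (insert p S)) (hHp : H p = 1)
    (hq : ContinuousAt q p) (hG : ∀ r ∈ S, r ^ 2 * mu M e Λ r = (r - p) * q r)
    (hR : ∀ r ∈ S, R r = H r) {x : ℝ} (hx : x ∈ I) : R x = 1 := by
  have hdF : ∀ r ∈ I, deriv (radialMomentum M e Λ R) r = 0 := fun r hr => by
    have := h.mu_mul_deriv_radialMomentum hr (h0 r hr)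
    simpa [hmu r hr] using this
  have hlim := tendsto_horizon_momentum (β := 0) (R := R)
    (G := fun r => (r : ℂ) ^ 2 * (mu M e Λ r : ℂ))
    hS hp hT hH hHp hq (fun r hr => by rw [← hG r hr]; push_cast; ring)
    (fun r hr => by simpa using hR r hr)
  have hF : ∀ y ∈ I, radialMomentum M e Λ R y = 0 := fun y hy => by
    refine tendsto_nhds_unique (f := fun _ => radialMomentum M e Λ R y) (l := 𝓝[S] p)
      tendsto_const_nhds ?_
    have h1 : Tendsto (radialMomentum M e Λ R) (𝓝[S] p) (𝓝 0) := by
      simp only [Complex.ofReal_zero, mul_zero, zero_mul, neg_zero, Complex.exp_zero, mul_one]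
        at hlim
      exact hlim
    refine h1.congr' ?_
    filter_upwards [self_mem_nhdsWithin] with r hr
    exact hI.is_const_of_deriv_eq_zero hI'
      (fun s hs => (h.differentiableAt_radialMomentum hs (h0 s hs)).differentiableWithinAt)
      hdF (hSI hr) hy
  have hdR : ∀ r ∈ I, deriv R r = 0 := fun r hr => by
    simpa [radialMomentum, hmu r hr, h0 r hr] using hF r hr
  have hHc : Tendsto H (𝓝[S] p) (𝓝 1) :=
    hHp ▸ (((hH.continuousOn) p (mem_insert _ _)).mono (subset_insert _ _)).tendsto
  refine tendsto_nhds_unique (f := fun _ => R x) (l := 𝓝[S] p) tendsto_const_nhds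
    (hHc.congr' ?_)
  filter_upwards [self_mem_nhdsWithin] with r hr
  rw [← hR r hr]
  exact hI.is_const_of_deriv_eq_zero hI' (fun s hs => (h.1 s hs).differentiableWithinAt)
    hdR (hSI hr) hx

/-- If two solutions are linearly dependent, their fluxes and values are proportional. -/
theorem normSq_mul_flux_eq {R₁ R₂ : ℝ → ℂ} (hI : IsOpen I)
    (h₁ : ∀ r ∈ I, DifferentiableAt ℝ R₁ r) (h₂ : ∀ r ∈ I, DifferentiableAt ℝ R₂ r)
    {a b : ℂ} (hab : ∀ r ∈ I, a * R₁ r + b * R₂ r = 0) {x : ℝ} (hx : x ∈ I) :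
    Complex.normSq a * (conj (R₁ x) * radialMomentum M e Λ R₁ x).im =
      Complex.normSq b * (conj (R₂ x) * radialMomentum M e Λ R₂ x).im := by
  have hd : a * deriv R₁ x + b * deriv R₂ x = 0 := by
    have h1 := (((h₁ x hx).hasDerivAt.const_mul a).add
      ((h₂ x hx).hasDerivAt.const_mul b)).deriv
    rw [← h1]
    have : (fun r => a * R₁ r) + (fun r => b * R₂ r) =ᶠ[𝓝 x] fun _ => 0 := by
      filter_upwards [hI.mem_nhds hx] with r hr using hab r hr
    rw [this.deriv_eq, deriv_const]
  have hv : conj a * conj (R₁ x) = -(conj b * conj (R₂ x)) := by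
    rw [← map_mul, ← map_mul, ← map_neg, eq_neg_of_add_eq_zero_left (hab x hx)]
  rw [← Complex.im_ofReal_mul, ← Complex.im_ofReal_mul, Complex.normSq_eq_conj_mul_self,
    Complex.normSq_eq_conj_mul_self]
  congr 1
  simp only [radialMomentum]
  linear_combination (a * (x : ℂ) ^ 2 * (mu M e Λ x : ℂ) * deriv R₁ x) * hv
    - (conj b * conj (R₂ x) * (x : ℂ) ^ 2 * (mu M e Λ x : ℂ)) * hd

theorem sq_mul_mu_eq_prod {rm rp rc : ℝ} (h₀ : 0 < rm) (h₁ : rm < rp) (h₂ : rp < rc)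
    (hzm : mu M e Λ rm = 0) (hzp : mu M e Λ rp = 0) (hzc : mu M e Λ rc = 0) {r : ℝ}
    (hr : r ≠ 0) :
    r ^ 2 * mu M e Λ r =
      -(Λ / 3) * (r - rm) * (r - rp) * (r - rc) * (r + rm + rp + rc) := by
  have key : ∀ s : ℝ, s ≠ 0 →
      s ^ 2 * mu M e Λ s = s ^ 2 - 2 * M * s + e ^ 2 - Λ / 3 * s ^ 4 := by
    intro s hs
    unfold mu
    field_simp
  have em := key rm h₀.ne'
  have ep := key rp (h₀.trans h₁).ne'
  have ec := key rc (h₀.trans (h₁.trans h₂)).ne'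
  rw [hzm, mul_zero] at em
  rw [hzp, mul_zero] at ep
  rw [hzc, mul_zero] at ec
  have e1 : (rm + rp) - 2 * M - Λ / 3 * (rm + rp) * (rm ^ 2 + rp ^ 2) = 0 := by
    apply mul_left_cancel₀ (sub_ne_zero.mpr h₁.ne)
    linear_combination ep - em
  have e2 : (rp + rc) - 2 * M - Λ / 3 * (rp + rc) * (rp ^ 2 + rc ^ 2) = 0 := by
    apply mul_left_cancel₀ (sub_ne_zero.mpr h₂.ne)
    linear_combination ec - ep
  have e3 : 1 - Λ / 3 * (rm ^ 2 + rp ^ 2 + rc ^ 2 + rm * rp + rm * rc + rp * rc) = 0 := by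
    apply mul_left_cancel₀ (sub_ne_zero.mpr (h₁.trans h₂).ne)
    linear_combination e1 - e2
  rw [key r hr]
  linear_combination -em + (r - rm) * e1 + (r - rm) * (r - rp) * e3

end Radial

/-- Non-triviality of reflexion: for some real frequency `ω`, the outgoing solution at
`r₊` and the ingoing solution at `r_c` are linearly independent over `ℂ`. -/
theorem nontrivial_reflexion (M e Λ rm rp rc : ℝ)
    (hM : 0 < M) (he : 0 < e) (hΛ : 0 < Λ)
    (h₀ : 0 < rm) (h₁ : rm < rp) (h₂ : rp < rc)
    (hzm : mu M e Λ rm = 0) (hzp : mu M e Λ rp = 0) (hzc : mu M e Λ rc = 0)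
    (Rout Rinc : ℝ → ℝ → ℂ)
    (hRout : ∀ ω : ℝ, SolvesODE M e Λ (ω : ℂ) (Set.Ioo rp rc) (Rout ω))
    (hRinc : ∀ ω : ℝ, SolvesODE M e Λ (ω : ℂ) (Set.Ioo rp rc) (Rinc ω))
    (δ : ℝ) (hδ : 0 < δ)
    (Hp : ℝ → ℝ → ℂ) (Hc : ℝ → ℝ → ℂ)
    (hHp : ∀ ω : ℝ, ContDiffOn ℝ 1 (Hp ω) (Set.Ico rp (rp + δ)) ∧ Hp ω rp = 1)
    (hHc : ∀ ω : ℝ, ContDiffOn ℝ 1 (Hc ω) (Set.Ioc (rc - δ) rc) ∧ Hc ω rc = 1)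
    (hformp : ∀ ω : ℝ, ∀ r ∈ Set.Ioo rp (rp + δ) ∩ Set.Ioo rp rc,
      Rout ω r = ((r - rp : ℝ) : ℂ) ^ ((Complex.I * ω) / (2 * (kappaP M e Λ rp : ℂ))) * Hp ω r)
    (hformc : ∀ ω : ℝ, ∀ r ∈ Set.Ioo (rc - δ) rc ∩ Set.Ioo rp rc,
      Rinc ω r = ((rc - r : ℝ) : ℂ) ^ (-(Complex.I * ω) / (2 * (kappaC M e Λ rc : ℂ))) * Hc ω r)
    (hcont : ∀ r ∈ Set.Ioo rp rc,
      Continuous (fun ω : ℝ => Rout ω r) ∧ Continuous (fun ω : ℝ => Rinc ω r)) :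
    ∃ ω : ℝ, ∀ a b : ℂ,
      (∀ r ∈ Set.Ioo rp rc, a * Rout ω r + b * Rinc ω r = 0) → a = 0 ∧ b = 0 := by
  have hpos : 0 < rp := h₀.trans h₁
  have hcpos : 0 < rc := hpos.trans h₂
  have hfac : ∀ r : ℝ, r ≠ 0 → r ^ 2 * mu M e Λ r =
      -(Λ / 3) * (r - rm) * (r - rp) * (r - rc) * (r + rm + rp + rc) :=
    fun r hr => sq_mul_mu_eq_prod h₀ h₁ h₂ hzm hzp hzc hr
  have h0 : ∀ r ∈ Ioo rp rc, r ≠ 0 := fun r hr => (hpos.trans hr.1).ne'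
  have hmu : ∀ r ∈ Ioo rp rc, mu M e Λ r ≠ 0 := by
    intro r hr
    refine right_ne_zero_of_mul (a := r ^ 2) ?_
    rw [hfac r (h0 r hr)]
    have a1 : r - rm ≠ 0 := sub_ne_zero.mpr (h₁.trans hr.1).ne'
    have a2 : r - rp ≠ 0 := sub_ne_zero.mpr hr.1.ne'
    have a3 : r - rc ≠ 0 := sub_ne_zero.mpr hr.2.ne
    have a4 : r + rm + rp + rc ≠ 0 := by have := hpos.trans hr.1; positivity
    simp [a1, a2, a3, a4, hΛ.ne']
  set qp : ℝ → ℝ := fun r => -(Λ / 3) * (r - rm) * (r - rc) * (r + rm + rp + rc) with hqp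
  set qc : ℝ → ℝ := fun r => -(Λ / 3) * (r - rm) * (r - rp) * (r + rm + rp + rc) with hqc
  have hqpd : Differentiable ℝ qp := by rw [hqp]; fun_prop
  have hqcd : Differentiable ℝ qc := by rw [hqc]; fun_prop
  have hfp : ∀ r ≠ 0, r ^ 2 * mu M e Λ r = (r - rp) * qp r := fun r hr => by
    rw [hfac r hr, hqp]; ring
  have hfc : ∀ r ≠ 0, r ^ 2 * mu M e Λ r = (r - rc) * qc r := fun r hr => by
    rw [hfac r hr, hqc]; ring
  have hdp : deriv (mu M e Λ) rp = qp rp / rp ^ 2 :=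
    (hasDerivAt_of_factor hpos.ne' (hqpd rp) hfp).deriv
  have hdc : deriv (mu M e Λ) rc = qc rc / rc ^ 2 :=
    (hasDerivAt_of_factor hcpos.ne' (hqcd rc) hfc).deriv
  have hdp0 : deriv (mu M e Λ) rp ≠ 0 := by
    rw [hdp]
    have a1 : rp - rm ≠ 0 := sub_ne_zero.mpr h₁.ne'
    have a3 : rp - rc ≠ 0 := sub_ne_zero.mpr h₂.ne
    have a4 : rp + rm + rp + rc ≠ 0 := by positivity
    simp [hqp, a1, a3, a4, hΛ.ne', hpos.ne']
  have hdc0 : deriv (mu M e Λ) rc ≠ 0 := by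
    rw [hdc]
    have a1 : rc - rm ≠ 0 := sub_ne_zero.mpr (h₁.trans h₂).ne'
    have a3 : rc - rp ≠ 0 := sub_ne_zero.mpr h₂.ne'
    have a4 : rc + rm + rp + rc ≠ 0 := by positivity
    simp [hqc, a1, a3, a4, hΛ.ne', hcpos.ne']
  have hqdp : qp rp = rp ^ 2 * deriv (mu M e Λ) rp := by rw [hdp]; field_simp
  have hqdc : qc rc = rc ^ 2 * deriv (mu M e Λ) rc := by rw [hdc]; field_simp
  have hP : rp < min (rp + δ) rc := lt_min (by linarith) h₂
  have hC : max (rc - δ) rp < rc := max_lt (by linarith) h₂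
  have hPI : Ioo rp (min (rp + δ) rc) ⊆ Ioo rp rc := Ioo_subset_Ioo_right (min_le_right _ _)
  have hCI : Ioo (max (rc - δ) rp) rc ⊆ Ioo rp rc := Ioo_subset_Ioo_left (le_max_right _ _)
  have hPne : (𝓝[Ioo rp (min (rp + δ) rc)] rp).NeBot := by
    rw [nhdsWithin_Ioo_eq_nhdsGT hP]; infer_instance
  have hCne : (𝓝[Ioo (max (rc - δ) rp) rc] rc).NeBot := by
    rw [nhdsWithin_Ioo_eq_nhdsLT hC]; infer_instance
  have hPu : UniqueDiffOn ℝ (insert rp (Ioo rp (min (rp + δ) rc))) := by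
    rw [Ioo_insert_left hP]; exact uniqueDiffOn_Ico _ _
  have hCu : UniqueDiffOn ℝ (insert rc (Ioo (max (rc - δ) rp) rc)) := by
    rw [Ioo_insert_right hC]; exact uniqueDiffOn_Ioc _ _
  have hPH : ∀ ω, ContDiffOn ℝ 1 (Hp ω) (insert rp (Ioo rp (min (rp + δ) rc))) := fun ω => by
    rw [Ioo_insert_left hP]
    exact (hHp ω).1.mono (Ico_subset_Ico_right (min_le_left _ _))
  have hCH : ∀ ω, ContDiffOn ℝ 1 (Hc ω) (insert rc (Ioo (max (rc - δ) rp) rc)) := fun ω => by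
    rw [Ioo_insert_right hC]
    exact (hHc ω).1.mono (Ioc_subset_Ioc_left (le_max_left _ _))
  have hPR : ∀ ω, ∀ r ∈ Ioo rp (min (rp + δ) rc), Rout ω r = ((|r - rp| : ℝ) : ℂ) ^
      (Complex.I * (ω / deriv (mu M e Λ) rp : ℝ)) * Hp ω r := fun ω r hr => by
    rw [hformp ω r ⟨⟨hr.1, hr.2.trans_le (min_le_left _ _)⟩, hPI hr⟩,
      abs_of_pos (sub_pos.mpr hr.1), kappaP]
    congr 2
    push_cast
    ring
  have hCR : ∀ ω, ∀ r ∈ Ioo (max (rc - δ) rp) rc, Rinc ω r = ((|r - rc| : ℝ) : ℂ) ^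
      (Complex.I * (ω / deriv (mu M e Λ) rc : ℝ)) * Hc ω r := fun ω r hr => by
    rw [hformc ω r ⟨⟨(le_max_left _ _).trans_lt hr.1, hr.2⟩, hCI hr⟩,
      abs_of_neg (sub_neg.mpr hr.2), neg_sub, kappaC]
    congr 2
    push_cast
    rw [show (2 : ℂ) * (-(1 / 2) * ((deriv (mu M e Λ) rc : ℝ) : ℂ)) =
      -((deriv (mu M e Λ) rc : ℝ) : ℂ) by ring,
      neg_div_neg_eq, mul_div_assoc]
  obtain ⟨x, hx⟩ : (Ioo rp rc).Nonempty := nonempty_Ioo.mpr h₂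
  have fluxP : ∀ ω, (conj (Rout ω x) * radialMomentum M e Λ (Rout ω) x).im = ω * rp ^ 2 :=
    fun ω => (hRout ω).flux_eq_of_horizon isOpen_Ioo isPreconnected_Ioo h0 hmu isOpen_Ioo hPI
      (by simp) hPne hPu (hPH ω) (hHp ω).2 hqpd.continuous.continuousAt
      (fun r hr => hfp r (h0 r (hPI hr))) hdp0 hqdp (hPR ω) hx
  have fluxC : ∀ ω, (conj (Rinc ω x) * radialMomentum M e Λ (Rinc ω) x).im = ω * rc ^ 2 :=
    fun ω => (hRinc ω).flux_eq_of_horizon isOpen_Ioo isPreconnected_Ioo h0 hmu isOpen_Ioo hCI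
      (by simp) hCne hCu (hCH ω) (hHc ω).2 hqcd.continuous.continuousAt
      (fun r hr => hfc r (h0 r (hCI hr))) hdc0 hqdc (hCR ω) hx
  have oneP : Rout 0 x = 1 :=
    (hRout 0).eq_one_of_static isOpen_Ioo isPreconnected_Ioo h0 hmu isOpen_Ioo hPI
      (by simp) hPne hPu (hPH 0) (hHp 0).2 hqpd.continuous.continuousAt
      (fun r hr => hfp r (h0 r (hPI hr))) (fun r hr => by simpa using hPR 0 r hr) hx
  have oneC : Rinc 0 x = 1 :=
    (hRinc 0).eq_one_of_static isOpen_Ioo isPreconnected_Ioo h0 hmu isOpen_Ioo hCI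
      (by simp) hCne hCu (hCH 0) (hHc 0).2 hqcd.continuous.continuousAt
      (fun r hr => hfc r (h0 r (hCI hr))) (fun r hr => by simpa using hCR 0 r hr) hx
  by_contra! hcon
  have key : ∀ ω ≠ 0, Complex.normSq (Rinc ω x) * rp ^ 2 = Complex.normSq (Rout ω x) * rc ^ 2 := by
    intro ω hω
    obtain ⟨a, b, hab, hne⟩ := hcon ω
    have h1 := normSq_mul_flux_eq (M := M) (e := e) (Λ := Λ) isOpen_Ioo
      (hRout ω).1 (hRinc ω).1 hab hx
    rw [fluxP, fluxC] at h1
    have h2 : Complex.normSq a * rp ^ 2 = Complex.normSq b * rc ^ 2 :=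
      mul_left_cancel₀ hω (by linear_combination h1)
    have h3 : Complex.normSq a * Complex.normSq (Rout ω x)
        = Complex.normSq b * Complex.normSq (Rinc ω x) := by
      rw [← Complex.normSq_mul, ← Complex.normSq_mul,
        eq_neg_of_add_eq_zero_left (hab x hx), Complex.normSq_neg]
    have hb : Complex.normSq b ≠ 0 := by
      intro hb
      have ha : Complex.normSq a = 0 := by
        rw [hb, zero_mul] at h2
        exact (mul_eq_zero.mp h2).resolve_right (by positivity)
      exact hne (Complex.normSq_eq_zero.mp ha) (Complex.normSq_eq_zero.mp hb)
    exact mul_left_cancel₀ hb (by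
      linear_combination Complex.normSq (Rout ω x) * h2 - rp ^ 2 * h3)
  have hlimP : Tendsto (fun ω => Complex.normSq (Rout ω x) * rc ^ 2) (𝓝[≠] 0) (𝓝 (rc ^ 2)) := by
    have h1 : Continuous (fun ω => Complex.normSq (Rout ω x) * rc ^ 2) :=
      (Complex.continuous_normSq.comp (hcont x hx).1).mul continuous_const
    simpa [oneP] using (h1.tendsto 0).mono_left (nhdsWithin_le_nhds (s := {0}ᶜ))
  have hlimC : Tendsto (fun ω => Complex.normSq (Rinc ω x) * rp ^ 2) (𝓝[≠] 0) (𝓝 (rp ^ 2)) := by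
    have h1 : Continuous (fun ω => Complex.normSq (Rinc ω x) * rp ^ 2) :=
      (Complex.continuous_normSq.comp (hcont x hx).2).mul continuous_const
    simpa [oneC] using (h1.tendsto 0).mono_left (nhdsWithin_le_nhds (s := {0}ᶜ))
  have heq : rp ^ 2 = rc ^ 2 := tendsto_nhds_unique hlimC (hlimP.congr' (by
    filter_upwards [self_mem_nhdsWithin] with ω hω using (key ω hω).symm))
  exact (pow_lt_pow_left₀ h₂ hpos.le two_ne_zero).ne heq
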